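/- arXiv:1810.09079 — 6 statements merged into one kernel-verified Lean document; each statement's English description precedes it below -/
import Mathlib

section
/- Let E be a finite-dimensional real inner product space (e.g., ℝ^d), let X ⊆ E be a nonempty set of finite diameter diam(X), and let P and Q be Borel probability measures on E supported in X. Let φ : E → ℝ be a strictly convex differentiable function whose gradient is L_φ-Lipschitz for some L_φ > 0. Then (1/(L_φ · diam(X)²)) · W_{D_φ}(P, Q) ≤ TV(P, Q) ≤ √((1/2) · KL(P ‖ Q)). -/
open MeasureTheory
open scoped RealInnerProductSpace ENNReal Classical

/-- The relaxed Wasserstein divergence `W_{D_φ}(P, Q)`: the infimum over all couplings `π`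
of `P` and `Q` of the integral of the Bregman divergence
`D_φ(x, y) = φ x - φ y - ⟪∇φ(y), x - y⟫`. -/
noncomputable def rwDiv {E : Type*} [NormedAddCommGroup E] [InnerProductSpace ℝ E]
    [CompleteSpace E] [MeasurableSpace E] (φ : E → ℝ) (P Q : Measure E) : ℝ :=
  sInf { r : ℝ | ∃ π : Measure (E × E), IsProbabilityMeasure π ∧
    π.map Prod.fst = P ∧ π.map Prod.snd = Q ∧
    r = ∫ z, (φ z.1 - φ z.2 - ⟪gradient φ z.2, z.1 - z.2⟫) ∂π }

/-- Total variation distance: the supremum over measurable sets of `|P A - Q A|`. -/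
noncomputable def tvDist {E : Type*} [MeasurableSpace E] (P Q : Measure E) : ℝ :=
  ⨆ A : { A : Set E // MeasurableSet A }, |(P A.1).toReal - (Q A.1).toReal|

/-- The Kullback–Leibler divergence `KL(P ‖ Q) = ∫ log (dP/dQ) dP`, equal to `+∞` if `P`
is not absolutely continuous with respect to `Q` (or if the integrand is not integrable). -/
noncomputable def klDiv' {E : Type*} [MeasurableSpace E] (P Q : Measure E) : ℝ≥0∞ :=
  if P ≪ Q ∧ Integrable (fun x => Real.log ((P.rnDeriv Q x).toReal)) P
  then ENNReal.ofReal (∫ x, Real.log ((P.rnDeriv Q x).toReal) ∂P) else ⊤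

section TotalVariation

variable {α : Type*} [MeasurableSpace α]

lemma abs_toReal_sub_le_tvDist (P Q : Measure α) [IsProbabilityMeasure P]
    [IsProbabilityMeasure Q] {A : Set α} (hA : MeasurableSet A) :
    |(P A).toReal - (Q A).toReal| ≤ tvDist P Q := by
  refine le_ciSup (f := fun A : { A : Set α // MeasurableSet A } =>
    |(P A.1).toReal - (Q A.1).toReal|) ⟨1, ?_⟩ ⟨A, hA⟩
  rintro _ ⟨B, rfl⟩
  change |P.real B.1 - Q.real B.1| ≤ 1
  have hp : P.real B.1 ≤ 1 := measureReal_le_one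
  have hq : Q.real B.1 ≤ 1 := measureReal_le_one
  have hp0 : 0 ≤ P.real B.1 := measureReal_nonneg
  have hq0 : 0 ≤ Q.real B.1 := measureReal_nonneg
  exact abs_le.2 ⟨by linarith, by linarith⟩

lemma tvDist_nonneg (P Q : Measure α) : 0 ≤ tvDist P Q :=
  Real.iSup_nonneg fun _ => abs_nonneg _

/-- Gluing the common part of `P` and `Q` along the diagonal and coupling the excess parts
independently gives a coupling whose off-diagonal mass is at most the total variation distance. -/
lemma exists_coupling_measure_ne_le_tvDist (P Q : Measure α) [IsProbabilityMeasure P]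
    [IsProbabilityMeasure Q] (hdiag : MeasurableSet {z : α × α | z.1 ≠ z.2}) :
    ∃ π : Measure (α × α), IsProbabilityMeasure π ∧ π.map Prod.fst = P ∧ π.map Prod.snd = Q ∧
      π.real {z | z.1 ≠ z.2} ≤ tvDist P Q := by
  obtain ⟨s, hs⟩ := exists_isHahnDecomposition Q P
  have hsm := hs.measurableSet
  set m := Q.restrict s + P.restrict sᶜ with hm
  set a := P.restrict s - Q.restrict s with ha
  set b := Q.restrict sᶜ - P.restrict sᶜ with hb
  have hma : m + a = P := by
    rw [hm, ha, add_right_comm, add_comm (Q.restrict s),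
      Measure.sub_add_cancel_of_le hs.le_on, Measure.restrict_add_restrict_compl hsm]
  have hmb : m + b = Q := by
    rw [hm, hb, add_assoc, add_comm (P.restrict sᶜ),
      Measure.sub_add_cancel_of_le hs.ge_on_compl, Measure.restrict_add_restrict_compl hsm]
  have hmtop : m Set.univ ≠ ∞ := measure_ne_top m _
  have hab : a Set.univ = b Set.univ := by
    have h1 : m Set.univ + a Set.univ = 1 := by
      rw [← Measure.add_apply, hma, measure_univ]
    have h2 : m Set.univ + b Set.univ = 1 := by
      rw [← Measure.add_apply, hmb, measure_univ]
    exact (ENNReal.add_right_inj hmtop).1 (h1.trans h2.symm)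
  have hatop : a Set.univ ≠ ∞ := measure_ne_top a _
  have hsmul : ∀ c : Measure α, c Set.univ = a Set.univ →
      ((a Set.univ)⁻¹ * a Set.univ) • c = c := by
    intro c hc
    rcases eq_or_ne (a Set.univ) 0 with h0 | h0
    · have : c = 0 := Measure.measure_univ_eq_zero.1 (hc.trans h0)
      simp [this]
    · rw [ENNReal.inv_mul_cancel h0 hatop, one_smul]
  have hd : Measurable fun x : α => (x, x) := measurable_id.prodMk measurable_id
  set π := m.map (fun x => (x, x)) + (a Set.univ)⁻¹ • a.prod b with hπ
  have hfst : π.map Prod.fst = P := by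
    rw [hπ, Measure.map_add _ _ measurable_fst, Measure.map_map measurable_fst hd,
      Measure.map_smul, Measure.map_fst_prod, smul_smul, ← hab, hsmul a rfl]
    simpa [Function.comp_def] using hma
  have hsnd : π.map Prod.snd = Q := by
    rw [hπ, Measure.map_add _ _ measurable_snd, Measure.map_map measurable_snd hd,
      Measure.map_smul, Measure.map_snd_prod, smul_smul, hsmul b hab.symm]
    simpa [Function.comp_def] using hmb
  have hprob : IsProbabilityMeasure π := by
    constructor
    rw [← Set.preimage_univ (f := Prod.fst), ← Measure.map_apply measurable_fst .univ, hfst,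
      measure_univ]
  refine ⟨π, hprob, hfst, hsnd, ?_⟩
  have hle : π {z | z.1 ≠ z.2} ≤ a Set.univ := by
    calc π {z | z.1 ≠ z.2} = (a Set.univ)⁻¹ * (a.prod b) {z | z.1 ≠ z.2} := by
          rw [hπ, Measure.add_apply, Measure.map_apply hd hdiag]
          simp
      _ ≤ (a Set.univ)⁻¹ * (a.prod b) Set.univ := by gcongr; exact Set.subset_univ _
      _ = ((a Set.univ)⁻¹ * a Set.univ) * a Set.univ := by
          rw [← Set.univ_prod_univ, Measure.prod_prod, ← hab, mul_assoc]
      _ ≤ 1 * a Set.univ := by gcongr; exact ENNReal.inv_mul_le_one _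
      _ = a Set.univ := one_mul _
  have ha_eq : a Set.univ = P s - Q s := by
    rw [ha, Measure.sub_apply .univ hs.le_on, Measure.restrict_apply_univ,
      Measure.restrict_apply_univ]
  have hQP : Q s ≤ P s := by simpa using hs.le_on Set.univ
  calc π.real {z | z.1 ≠ z.2} ≤ (a Set.univ).toReal := ENNReal.toReal_mono hatop hle
    _ = (P s).toReal - (Q s).toReal := by
      rw [ha_eq, ENNReal.toReal_sub_of_le hQP (measure_ne_top _ _)]
    _ ≤ |(P s).toReal - (Q s).toReal| := le_abs_self _
    _ ≤ tvDist P Q := abs_toReal_sub_le_tvDist P Q hsm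

/-- Pinsker's inequality on a single event: the Gibbs variational bound at a multiple of the
indicator of the event, combined with Hoeffding's lemma. -/
lemma two_mul_sq_measureReal_sub_le_integral_llr (P Q : Measure α) [IsProbabilityMeasure P]
    [IsProbabilityMeasure Q] (hPQ : P ≪ Q) (hint : Integrable (llr P Q) P) {A : Set α}
    (hA : MeasurableSet A) :
    2 * (P.real A - Q.real A) ^ 2 ≤ ∫ x, llr P Q x ∂P := by
  set X : α → ℝ := A.indicator 1 with hX
  have hXm : Measurable X := measurable_one.indicator hA
  have hX01 : ∀ x, X x ∈ Set.Icc (0 : ℝ) 1 := fun x => by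
    by_cases hx : x ∈ A <;> simp [hX, hx]
  have hXP : ∫ x, X x ∂P = P.real A := integral_indicator_one hA
  have hXQ : ∫ x, X x ∂Q = Q.real A := integral_indicator_one hA
  have hXi : Integrable X P := Integrable.of_mem_Icc 0 1 hXm.aemeasurable (.of_forall hX01)
  have hsub := ProbabilityTheory.hasSubgaussianMGF_of_mem_Icc (μ := Q) hXm.aemeasurable
    (.of_forall hX01)
  rw [hXQ] at hsub
  set t : ℝ := 4 * (P.real A - Q.real A) with ht
  have hexp := hsub.integrable_exp_mul t
  have hfP : Integrable (fun x => t * (X x - Q.real A)) P :=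
    (hXi.sub (integrable_const _)).const_mul t
  have hprob : IsProbabilityMeasure (Q.tilted fun x => t * (X x - Q.real A)) :=
    isProbabilityMeasure_tilted hexp
  have hgibbs := InformationTheory.integral_llr_add_sub_measure_univ_nonneg
    (hPQ.trans (absolutelyContinuous_tilted hexp))
    (integrable_llr_tilted_right hPQ hfP hint hexp)
  rw [integral_llr_tilted_right hPQ hfP hexp hint, integral_const_mul,
    integral_sub hXi (integrable_const _), hXP] at hgibbs
  have hmgf : Real.log (∫ x, Real.exp (t * (X x - Q.real A)) ∂Q) ≤ t ^ 2 / 8 := by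
    have h := hsub.mgf_le t
    rw [ProbabilityTheory.mgf] at h
    rw [Real.log_le_iff_le_exp (integral_exp_pos hexp)]
    refine h.trans (Real.exp_le_exp.2 (le_of_eq ?_))
    norm_num
    ring
  simp only [integral_const, probReal_univ, smul_eq_mul, one_mul] at hgibbs
  nlinarith

lemma ofReal_tvDist_le_sqrt_half_klDiv' (P Q : Measure α) [IsProbabilityMeasure P]
    [IsProbabilityMeasure Q] :
    ENNReal.ofReal (tvDist P Q) ≤ (klDiv' P Q / 2) ^ (1 / 2 : ℝ) := by
  unfold klDiv'
  split_ifs with h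
  · obtain ⟨hPQ, hint⟩ := h
    set K := ∫ x, Real.log ((P.rnDeriv Q x).toReal) ∂P
    have key : ∀ A : Set α, MeasurableSet A → 2 * (P.real A - Q.real A) ^ 2 ≤ K := fun A hA =>
      two_mul_sq_measureReal_sub_le_integral_llr P Q hPQ hint hA
    have hK0 : 0 ≤ K := by simpa using key ∅ .empty
    have htv : tvDist P Q ≤ √(K / 2) := by
      have : Nonempty { A : Set α // MeasurableSet A } := ⟨⟨∅, .empty⟩⟩
      refine ciSup_le fun A => Real.abs_le_sqrt ?_
      have := key A.1 A.2
      simp only [measureReal_def] at this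
      linarith
    have h2 : ENNReal.ofReal K / 2 = ENNReal.ofReal (K / 2) := by
      rw [ENNReal.ofReal_div_of_pos two_pos, ENNReal.ofReal_ofNat]
    rw [h2, ENNReal.ofReal_rpow_of_nonneg (by positivity) (by norm_num), ← Real.sqrt_eq_rpow]
    exact ENNReal.ofReal_le_ofReal htv
  · rw [ENNReal.top_div_of_ne_top (by norm_num), ENNReal.top_rpow_of_pos (by norm_num)]
    exact le_top

end TotalVariation

section Bregman

variable {E : Type*} [NormedAddCommGroup E] [InnerProductSpace ℝ E] [CompleteSpace E]
  {φ : E → ℝ}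

lemma ConvexOn.bregman_nonneg (hconv : ConvexOn ℝ Set.univ φ) (hdiff : Differentiable ℝ φ)
    (x y : E) : 0 ≤ φ x - φ y - ⟪gradient φ y, x - y⟫ := by
  have hc : ConvexOn ℝ Set.univ (φ ∘ AffineMap.lineMap (k := ℝ) y x) := by
    simpa using hconv.comp_affineMap (AffineMap.lineMap (k := ℝ) y x)
  have hd : HasDerivAt (φ ∘ AffineMap.lineMap (k := ℝ) y x) ⟪gradient φ y, x - y⟫ 0 := by
    have h1 : HasFDerivAt φ (InnerProductSpace.toDual ℝ E (gradient φ y))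
        (AffineMap.lineMap (k := ℝ) y x (0 : ℝ)) := by
      rw [AffineMap.lineMap_apply_zero]
      exact (hdiff y).hasGradientAt.hasFDerivAt
    simpa using h1.comp_hasDerivAt (0 : ℝ) AffineMap.hasDerivAt_lineMap
  have := hc.le_slope_of_hasDerivAt (Set.mem_univ 0) (Set.mem_univ 1) zero_lt_one hd
  simp only [slope_def_field, Function.comp_apply, AffineMap.lineMap_apply_zero,
    AffineMap.lineMap_apply_one, sub_zero, div_one] at this
  linarith

lemma ConvexOn.bregman_le_of_lipschitz_gradient (hconv : ConvexOn ℝ Set.univ φ)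
    (hdiff : Differentiable ℝ φ) {L : ℝ}
    (hlip : ∀ x y : E, ‖gradient φ x - gradient φ y‖ ≤ L * ‖x - y‖) (x y : E) :
    φ x - φ y - ⟪gradient φ y, x - y⟫ ≤ L * ‖x - y‖ ^ 2 := by
  have h1 := hconv.bregman_nonneg hdiff y x
  have h2 : ⟪gradient φ x, y - x⟫ = -⟪gradient φ x, x - y⟫ := by
    rw [← inner_neg_right, neg_sub]
  calc φ x - φ y - ⟪gradient φ y, x - y⟫
      ≤ ⟪gradient φ x - gradient φ y, x - y⟫ := by rw [inner_sub_left]; linarith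
    _ ≤ ‖gradient φ x - gradient φ y‖ * ‖x - y‖ := real_inner_le_norm _ _
    _ ≤ L * ‖x - y‖ * ‖x - y‖ := by gcongr; exact hlip x y
    _ = L * ‖x - y‖ ^ 2 := by ring

lemma rwDiv_le_mul_tvDist [SecondCountableTopology E] [MeasurableSpace E] [BorelSpace E]
    {X : Set E} (hXb : Bornology.IsBounded X) (P Q : Measure E) [IsProbabilityMeasure P]
    [IsProbabilityMeasure Q] (hP : P Xᶜ = 0) (hQ : Q Xᶜ = 0)
    (hconv : ConvexOn ℝ Set.univ φ) (hdiff : Differentiable ℝ φ) {L : ℝ} (hL : 0 ≤ L)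
    (hlip : ∀ x y : E, ‖gradient φ x - gradient φ y‖ ≤ L * ‖x - y‖) :
    rwDiv φ P Q ≤ L * Metric.diam X ^ 2 * tvDist P Q := by
  have hne : MeasurableSet {z : E × E | z.1 ≠ z.2} :=
    (measurableSet_eq_fun measurable_fst measurable_snd).compl
  obtain ⟨π, hπ, hfst, hsnd, hle⟩ := exists_coupling_measure_ne_le_tvDist P Q hne
  have hbdd : BddBelow { r : ℝ | ∃ π : Measure (E × E), IsProbabilityMeasure π ∧
      π.map Prod.fst = P ∧ π.map Prod.snd = Q ∧
      r = ∫ z, (φ z.1 - φ z.2 - ⟪gradient φ z.2, z.1 - z.2⟫) ∂π } := by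
    refine ⟨0, ?_⟩
    rintro _ ⟨π, -, -, -, rfl⟩
    exact integral_nonneg fun z => hconv.bregman_nonneg hdiff _ _
  refine (csInf_le hbdd ⟨π, hπ, hfst, hsnd, rfl⟩).trans ?_
  have hX1 : ∀ᵐ z ∂π, z.1 ∈ X := by
    refine ae_of_ae_map (f := Prod.fst) (p := (· ∈ X)) measurable_fst.aemeasurable ?_
    rw [hfst]
    exact hP
  have hX2 : ∀ᵐ z ∂π, z.2 ∈ X := by
    refine ae_of_ae_map (f := Prod.snd) (p := (· ∈ X)) measurable_snd.aemeasurable ?_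
    rw [hsnd]
    exact hQ
  set C := L * Metric.diam X ^ 2 with hC
  calc ∫ z, (φ z.1 - φ z.2 - ⟪gradient φ z.2, z.1 - z.2⟫) ∂π
      ≤ ∫ z, {z : E × E | z.1 ≠ z.2}.indicator (fun _ => C) z ∂π := by
        refine integral_mono_of_nonneg (.of_forall fun z => hconv.bregman_nonneg hdiff _ _)
          ((integrable_const C).indicator hne) ?_
        filter_upwards [hX1, hX2] with z h1 h2
        by_cases hz : z.1 = z.2
        · simp [hz]
        · rw [Set.indicator_of_mem (show z ∈ {z : E × E | z.1 ≠ z.2} from hz)]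
          refine (hconv.bregman_le_of_lipschitz_gradient hdiff hlip z.1 z.2).trans ?_
          rw [hC, ← dist_eq_norm]
          gcongr
          exact Metric.dist_le_diam_of_mem hXb h1 h2
    _ = C * π.real {z | z.1 ≠ z.2} := by
        rw [integral_indicator_const _ hne, smul_eq_mul, mul_comm]
    _ ≤ C * tvDist P Q := by gcongr

end Bregman

/-- **Theorem 1.** For probability measures `P`, `Q` supported in a nonempty bounded set `X`
of a finite-dimensional real inner product space, and `φ` strictly convex differentiable with
`L_φ`-Lipschitz gradient:
`(1/(L_φ · diam(X)²)) · W_{D_φ}(P, Q) ≤ TV(P, Q) ≤ √((1/2) · KL(P ‖ Q))`. -/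
theorem stmt0 {E : Type*} [NormedAddCommGroup E] [InnerProductSpace ℝ E]
    [FiniteDimensional ℝ E] [MeasurableSpace E] [BorelSpace E]
    (X : Set E) (hXne : X.Nonempty) (hXb : Bornology.IsBounded X)
    (P Q : Measure E) [IsProbabilityMeasure P] [IsProbabilityMeasure Q]
    (hP : P Xᶜ = 0) (hQ : Q Xᶜ = 0)
    (φ : E → ℝ) (hconv : StrictConvexOn ℝ Set.univ φ) (hdiff : Differentiable ℝ φ)
    (L : ℝ) (hL : 0 < L)
    (hlip : ∀ x y : E, ‖gradient φ x - gradient φ y‖ ≤ L * ‖x - y‖) :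
    1 / (L * Metric.diam X ^ 2) * rwDiv φ P Q ≤ tvDist P Q ∧
      ENNReal.ofReal (tvDist P Q) ≤ (klDiv' P Q / 2) ^ (1 / 2 : ℝ) := by
  refine ⟨?_, ofReal_tvDist_le_sqrt_half_klDiv' P Q⟩
  have h := rwDiv_le_mul_tvDist hXb P Q hP hQ hconv.convexOn hdiff hL.le hlip
  rcases eq_or_lt_of_le (show 0 ≤ L * Metric.diam X ^ 2 by positivity) with h0 | h0
  · simpa [← h0] using tvDist_nonneg P Q
  · rw [one_div_mul_eq_div, div_le_iff₀ h0]
    linarith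
end

section
/- Let E be a finite-dimensional real inner product space, let X ⊆ E be a nonempty set of finite diameter diam(X), and let P and Q be Borel probability measures on E supported in X. Let φ : E → ℝ be a strictly convex differentiable function whose gradient is L_φ-Lipschitz for some L_φ > 0. Then W_{D_φ}(P, Q) ≤ L_φ · diam(X)² · TV(P, Q). -/
open MeasureTheory
open scoped RealInnerProductSpace

theorem ConvexOn.inner_gradient_le_sub {E : Type*} [NormedAddCommGroup E] [InnerProductSpace ℝ E]
    [CompleteSpace E] {φ : E → ℝ} (hconv : ConvexOn ℝ Set.univ φ) {x y : E}
    (hdiff : DifferentiableAt ℝ φ y) : ⟪gradient φ y, x - y⟫ ≤ φ x - φ y := by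
  have hline : ConvexOn ℝ Set.univ (φ ∘ AffineMap.lineMap (k := ℝ) y x) :=
    hconv.comp_affineMap (AffineMap.lineMap y x)
  have hderiv : HasDerivAt (φ ∘ AffineMap.lineMap (k := ℝ) y x) ⟪gradient φ y, x - y⟫ 0 := by
    have h : HasFDerivAt φ (InnerProductSpace.toDual ℝ E (gradient φ y))
        (AffineMap.lineMap y x (0 : ℝ)) := by
      simpa using hdiff.hasGradientAt.hasFDerivAt
    simpa using h.comp_hasDerivAt (0 : ℝ) AffineMap.hasDerivAt_lineMap
  simpa [slope_def_field] using
    hline.le_slope_of_hasDerivAt (Set.mem_univ 0) (Set.mem_univ 1) one_pos hderiv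

/-- The Bregman divergence of a convex function whose gradient is `L`-Lipschitz is at most
`L * ‖x - y‖ ^ 2`. -/
theorem ConvexOn.bregman_le {E : Type*} [NormedAddCommGroup E] [InnerProductSpace ℝ E]
    [CompleteSpace E] {φ : E → ℝ} (hconv : ConvexOn ℝ Set.univ φ) {L : ℝ} {x y : E}
    (hdiff : DifferentiableAt ℝ φ x)
    (hlip : ‖gradient φ x - gradient φ y‖ ≤ L * ‖x - y‖) :
    φ x - φ y - ⟪gradient φ y, x - y⟫ ≤ L * ‖x - y‖ ^ 2 := by
  have h₁ := hconv.inner_gradient_le_sub (x := y) hdiff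
  rw [← neg_sub x y, inner_neg_right] at h₁
  have h₂ : ⟪gradient φ x - gradient φ y, x - y⟫ ≤ L * ‖x - y‖ * ‖x - y‖ :=
    (real_inner_le_norm _ _).trans (by gcongr)
  rw [inner_sub_left] at h₂
  nlinarith

/-- Two probability measures admit a coupling which charges the complement of the diagonal by no
more than the difference of their values on some measurable set. -/
theorem exists_coupling_compl_diagonal_le {α : Type*} [MeasurableSpace α] [MeasurableEq α]
    (P Q : Measure α) [IsProbabilityMeasure P] [IsProbabilityMeasure Q] :
    ∃ A : Set α, MeasurableSet A ∧ ∃ π : Measure (α × α),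
      π.map Prod.fst = P ∧ π.map Prod.snd = Q ∧
      π (Set.diagonal α)ᶜ ≤ P A - Q A := by
  obtain ⟨A, hA, hQP, hPQ⟩ := exists_isHahnDecomposition Q P
  set a := P.restrict A - Q.restrict A with ha
  set b := Q.restrict Aᶜ - P.restrict Aᶜ with hb
  set m := Q.restrict A + P.restrict Aᶜ with hm
  have haP : a + m = P := by
    rw [hm, ← add_assoc, Measure.sub_add_cancel_of_le hQP, Measure.restrict_add_restrict_compl hA]
  have hbQ : b + m = Q := by
    rw [hm, add_left_comm, Measure.sub_add_cancel_of_le hPQ, Measure.restrict_add_restrict_compl hA]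
  have ha_univ : a Set.univ = P A - Q A := by
    rw [ha, Measure.sub_apply MeasurableSet.univ hQP]; simp
  have : IsFiniteMeasure a := isFiniteMeasure_of_le P (haP ▸ Measure.le_add_right le_rfl)
  have : IsFiniteMeasure b := isFiniteMeasure_of_le Q (hbQ ▸ Measure.le_add_right le_rfl)
  have hab : b Set.univ = a Set.univ := by
    have h₁ : a Set.univ + m Set.univ = 1 := by rw [← Measure.add_apply, haP, measure_univ]
    have h₂ : b Set.univ + m Set.univ = 1 := by rw [← Measure.add_apply, hbQ, measure_univ]
    exact (ENNReal.add_left_inj (measure_ne_top m _)).1 (h₂.trans h₁.symm)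
  have hscale (c : Measure α) [IsFiniteMeasure c] (hc : c Set.univ = a Set.univ) :
      (a Set.univ)⁻¹ • a Set.univ • c = c := by
    rcases eq_or_ne (a Set.univ) 0 with h | h
    · simp [Measure.measure_univ_eq_zero.1 (hc.trans h)]
    · rw [smul_smul, ENNReal.inv_mul_cancel h (measure_ne_top a _), one_smul]
  have hdiag : Measurable fun x : α ↦ (x, x) := measurable_id.prodMk measurable_id
  refine ⟨A, hA, m.map (fun x ↦ (x, x)) + (a Set.univ)⁻¹ • a.prod b, ?_, ?_, ?_⟩
  · rw [Measure.map_add _ _ measurable_fst, Measure.map_map measurable_fst hdiag,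
      Measure.map_smul, Measure.map_fst_prod, hab, hscale a rfl, add_comm]
    simpa [Function.comp_def] using haP
  · rw [Measure.map_add _ _ measurable_snd, Measure.map_map measurable_snd hdiag,
      Measure.map_smul, Measure.map_snd_prod, hscale b hab, add_comm]
    simpa [Function.comp_def] using hbQ
  · have hzero : m.map (fun x ↦ (x, x)) (Set.diagonal α)ᶜ = 0 := by
      rw [Measure.map_apply hdiag measurableSet_diagonal.compl]
      simp [Set.preimage, Set.mem_diagonal_iff]
    rw [Measure.add_apply, hzero, zero_add, ← ha_univ]
    calc ((a Set.univ)⁻¹ • a.prod b) (Set.diagonal α)ᶜ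
        ≤ ((a Set.univ)⁻¹ • a.prod b) Set.univ := measure_mono (Set.subset_univ _)
      _ = ((a Set.univ)⁻¹ • a Set.univ • a) Set.univ := by
        simp [← Set.univ_prod_univ, Measure.prod_prod, hab]
      _ = a Set.univ := by rw [hscale a rfl]

theorem sub_toReal_le_tvDist {E : Type*} [MeasurableSpace E] (P Q : Measure E)
    [IsProbabilityMeasure P] [IsProbabilityMeasure Q] {A : Set E} (hA : MeasurableSet A) :
    (P A - Q A).toReal ≤ tvDist P Q := by
  have hbdd : BddAbove (Set.range fun A : { A : Set E // MeasurableSet A } ↦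
      |(P A.1).toReal - (Q A.1).toReal|) := by
    refine ⟨1, ?_⟩
    rintro _ ⟨B, rfl⟩
    have h₁ : (P B.1).toReal ≤ 1 := measureReal_le_one
    have h₂ : (Q B.1).toReal ≤ 1 := measureReal_le_one
    have h₃ : 0 ≤ (P B.1).toReal := ENNReal.toReal_nonneg
    have h₄ : 0 ≤ (Q B.1).toReal := ENNReal.toReal_nonneg
    exact abs_le.2 ⟨by linarith, by linarith⟩
  refine le_trans ?_ (le_ciSup hbdd ⟨A, hA⟩)
  rcases le_total (Q A) (P A) with h | h
  · rw [ENNReal.toReal_sub_of_le h (measure_ne_top P A)]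
    exact le_abs_self _
  · simp [tsub_eq_zero_of_le h]

/-- For probability measures `P`, `Q` supported in a nonempty bounded set `X` of a
finite-dimensional real inner product space, and `φ` strictly convex differentiable with
`L_φ`-Lipschitz gradient: `W_{D_φ}(P, Q) ≤ L_φ · diam(X)² · TV(P, Q)`. -/
theorem stmt1 {E : Type*} [NormedAddCommGroup E] [InnerProductSpace ℝ E]
    [FiniteDimensional ℝ E] [MeasurableSpace E] [BorelSpace E]
    (X : Set E) (hXne : X.Nonempty) (hXb : Bornology.IsBounded X)
    (P Q : Measure E) [IsProbabilityMeasure P] [IsProbabilityMeasure Q]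
    (hP : P Xᶜ = 0) (hQ : Q Xᶜ = 0)
    (φ : E → ℝ) (hconv : StrictConvexOn ℝ Set.univ φ) (hdiff : Differentiable ℝ φ)
    (L : ℝ) (hL : 0 < L)
    (hlip : ∀ x y : E, ‖gradient φ x - gradient φ y‖ ≤ L * ‖x - y‖) :
    rwDiv φ P Q ≤ L * Metric.diam X ^ 2 * tvDist P Q := by
  obtain ⟨A, hA, π, hπP, hπQ, hπ⟩ := exists_coupling_compl_diagonal_le P Q
  have hprob : IsProbabilityMeasure π := ⟨by
    rw [← Set.preimage_univ (f := Prod.fst), ← Measure.map_apply measurable_fst MeasurableSet.univ,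
      hπP, measure_univ]⟩
  have hnonneg (z : E × E) : 0 ≤ φ z.1 - φ z.2 - ⟪gradient φ z.2, z.1 - z.2⟫ :=
    sub_nonneg.2 (hconv.convexOn.inner_gradient_le_sub (hdiff z.2))
  have hfst : ∀ᵐ z ∂π, z.1 ∈ X := ae_of_ae_map measurable_fst.aemeasurable (by rwa [hπP])
  have hsnd : ∀ᵐ z ∂π, z.2 ∈ X := ae_of_ae_map measurable_snd.aemeasurable (by rwa [hπQ])
  have hdiag : MeasurableSet (Set.diagonal E)ᶜ := measurableSet_diagonal.compl
  calc rwDiv φ P Q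
      ≤ ∫ z, (φ z.1 - φ z.2 - ⟪gradient φ z.2, z.1 - z.2⟫) ∂π := by
        refine csInf_le ⟨0, ?_⟩ ⟨π, hprob, hπP, hπQ, rfl⟩
        rintro _ ⟨_, _, _, _, rfl⟩
        exact integral_nonneg hnonneg
    _ ≤ ∫ z, (Set.diagonal E)ᶜ.indicator (fun _ ↦ L * Metric.diam X ^ 2) z ∂π := by
        refine integral_mono_of_nonneg (ae_of_all _ hnonneg)
          ((integrable_const _).indicator hdiag) ?_
        filter_upwards [hfst, hsnd] with z h₁ h₂
        by_cases hz : z.1 = z.2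
        · simp [hz, Set.indicator]
        · rw [Set.indicator_of_mem (by simpa using hz)]
          refine (hconv.convexOn.bregman_le (hdiff z.1) (hlip z.1 z.2)).trans ?_
          have := Metric.dist_le_diam_of_mem hXb h₁ h₂
          rw [dist_eq_norm] at this
          gcongr
    _ = L * Metric.diam X ^ 2 * (π (Set.diagonal E)ᶜ).toReal := by
        rw [integral_indicator_const _ hdiag, smul_eq_mul, mul_comm, measureReal_def]
    _ ≤ L * Metric.diam X ^ 2 * tvDist P Q := by
        gcongr
        exact (ENNReal.toReal_mono (ENNReal.sub_ne_top (measure_ne_top P A)) hπ).trans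
          (sub_toReal_le_tvDist P Q hA)
end

section
/- Let E be a finite-dimensional real inner product space, let X ⊆ E be a nonempty set of finite diameter M, let P and Q be Borel probability measures on E supported in X, and let φ : E → ℝ be a convex differentiable function with L-Lipschitz gradient. Then for every coupling π of P and Q, ∫ D_φ(x, y) dπ(x, y) ≤ (L/2) · M² · π({(x, y) : x ≠ y}). -/
open MeasureTheory
open scoped RealInnerProductSpace

/-- The descent lemma: a differentiable function with `L`-Lipschitz gradient lies below its
quadratic upper model. -/
theorem sub_sub_inner_gradient_le {E : Type*} [NormedAddCommGroup E] [InnerProductSpace ℝ E]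
    [CompleteSpace E] {φ : E → ℝ} (hdiff : Differentiable ℝ φ) {L : ℝ}
    (hlip : ∀ x y : E, ‖gradient φ x - gradient φ y‖ ≤ L * ‖x - y‖) (x y : E) :
    φ x - φ y - ⟪gradient φ y, x - y⟫ ≤ L / 2 * ‖x - y‖ ^ 2 := by
  set v := x - y with hv
  let f : ℝ → ℝ := fun t ↦ φ (y + t • v) - t * ⟪gradient φ y, v⟫ - L / 2 * ‖v‖ ^ 2 * t ^ 2
  have hf (t : ℝ) : HasDerivAt f
      (⟪gradient φ (y + t • v) - gradient φ y, v⟫ - L * ‖v‖ ^ 2 * t) t := by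
    have hline : HasDerivAt (fun t : ℝ ↦ y + t • v) v t := by
      simpa using ((hasDerivAt_id t).smul_const v).const_add y
    have hφ : HasDerivAt (fun t : ℝ ↦ φ (y + t • v)) ⟪gradient φ (y + t • v), v⟫ t := by
      have hfderiv := (hdiff (y + t • v)).hasGradientAt.hasFDerivAt
      rw [← InnerProductSpace.toDual_apply_apply (𝕜 := ℝ)]
      exact hfderiv.comp_hasDerivAt t hline
    refine ((hφ.sub ((hasDerivAt_id t).mul_const ⟪gradient φ y, v⟫)).sub
      (((hasDerivAt_id t).pow 2).const_mul (L / 2 * ‖v‖ ^ 2))).congr_deriv ?_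
    rw [inner_sub_left]
    simp
    ring
  have hanti : AntitoneOn f (Set.Icc 0 1) := by
    refine antitoneOn_of_deriv_nonpos (convex_Icc 0 1)
      (fun t _ ↦ (hf t).continuousAt.continuousWithinAt)
      (fun t _ ↦ (hf t).differentiableAt.differentiableWithinAt) fun t ht ↦ ?_
    rw [interior_Icc] at ht
    rw [(hf t).deriv, sub_nonpos]
    calc ⟪gradient φ (y + t • v) - gradient φ y, v⟫
        ≤ ‖gradient φ (y + t • v) - gradient φ y‖ * ‖v‖ := real_inner_le_norm _ _
      _ ≤ L * ‖y + t • v - y‖ * ‖v‖ := by gcongr; exact hlip _ _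
      _ = L * ‖v‖ ^ 2 * t := by
        rw [add_sub_cancel_left, norm_smul, Real.norm_of_nonneg ht.1.le]
        ring
  have h := hanti (Set.left_mem_Icc.2 zero_le_one) (Set.right_mem_Icc.2 zero_le_one) zero_le_one
  simp only [f, one_smul, zero_smul, add_zero, hv, add_sub_cancel] at h
  rw [← hv] at h
  linarith

/-- Let `X` be a nonempty bounded subset of a finite-dimensional real inner product space `E`
with diameter `M`, let `P`, `Q` be Borel probability measures supported in `X`, and let
`φ : E → ℝ` be convex differentiable with `L`-Lipschitz gradient. Then for every coupling `π`
of `P` and `Q`, `∫ D_φ(x, y) dπ(x, y) ≤ (L/2) · M² · π({(x, y) : x ≠ y})`. -/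
theorem stmt4 {E : Type*} [NormedAddCommGroup E] [InnerProductSpace ℝ E]
    [FiniteDimensional ℝ E] [MeasurableSpace E] [BorelSpace E]
    (X : Set E) (hXne : X.Nonempty) (hXb : Bornology.IsBounded X)
    (P Q : Measure E) [IsProbabilityMeasure P] [IsProbabilityMeasure Q]
    (hP : P Xᶜ = 0) (hQ : Q Xᶜ = 0)
    (φ : E → ℝ) (hconv : ConvexOn ℝ Set.univ φ) (hdiff : Differentiable ℝ φ)
    (L : ℝ) (hL : 0 ≤ L)
    (hlip : ∀ x y : E, ‖gradient φ x - gradient φ y‖ ≤ L * ‖x - y‖)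
    (π : Measure (E × E)) [IsProbabilityMeasure π]
    (hπ₁ : π.map Prod.fst = P) (hπ₂ : π.map Prod.snd = Q) :
    ∫ z, (φ z.1 - φ z.2 - ⟪gradient φ z.2, z.1 - z.2⟫) ∂π ≤
      L / 2 * Metric.diam X ^ 2 * (π {z : E × E | z.1 ≠ z.2}).toReal := by
  have hfst : ∀ᵐ z ∂π, z.1 ∈ X :=
    ae_of_ae_map measurable_fst.aemeasurable (by rw [hπ₁]; exact hP)
  have hsnd : ∀ᵐ z ∂π, z.2 ∈ X :=
    ae_of_ae_map measurable_snd.aemeasurable (by rw [hπ₂]; exact hQ)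
  have hS : MeasurableSet {z : E × E | z.1 ≠ z.2} :=
    (measurableSet_eq_fun measurable_fst measurable_snd).compl
  by_cases hint : Integrable (fun z : E × E ↦ φ z.1 - φ z.2 - ⟪gradient φ z.2, z.1 - z.2⟫) π
  · calc ∫ z, (φ z.1 - φ z.2 - ⟪gradient φ z.2, z.1 - z.2⟫) ∂π
        ≤ ∫ z, {z : E × E | z.1 ≠ z.2}.indicator
            (fun _ ↦ L / 2 * Metric.diam X ^ 2) z ∂π := by
          refine integral_mono_ae hint ((integrable_const _).indicator hS) ?_
          filter_upwards [hfst, hsnd] with z h1 h2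
          by_cases hz : z.1 = z.2
          · simp [hz]
          · rw [Set.indicator_of_mem (show z ∈ {z : E × E | z.1 ≠ z.2} from hz)]
            refine (sub_sub_inner_gradient_le hdiff hlip z.1 z.2).trans ?_
            gcongr
            rw [← dist_eq_norm]
            exact Metric.dist_le_diam_of_mem hXb h1 h2
      _ = L / 2 * Metric.diam X ^ 2 * (π {z : E × E | z.1 ≠ z.2}).toReal := by
          rw [integral_indicator_const _ hS, smul_eq_mul, mul_comm, Measure.real]
  · rw [integral_undef hint]
    positivity
end

section
/- For every d ≥ 1 and every x ∈ ℝ^d, there exists a unique τ ∈ ℝ such that Σ_{j=1}^d max(0, x_j − τ) = 1. -/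
theorem sum_max_zero_sub_lt_of_lt {ι : Type*} [Fintype ι] (x : ι → ℝ) {σ τ : ℝ} (h : σ < τ)
    (hτ : 0 < ∑ j, max 0 (x j - τ)) :
    ∑ j, max 0 (x j - τ) < ∑ j, max 0 (x j - σ) := by
  obtain ⟨i, hi, hpos⟩ := Finset.exists_lt_of_sum_lt (f := fun _ => (0 : ℝ)) (by simpa using hτ)
  have hxi : 0 < x i - τ := by simpa using hpos
  refine Finset.sum_lt_sum (fun j _ => by gcongr) ⟨i, hi, ?_⟩
  rw [max_eq_right hxi.le, max_eq_right (by linarith)]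
  linarith

theorem exists_sum_max_zero_sub_eq_one {ι : Type*} [Fintype ι] [Nonempty ι] (x : ι → ℝ) :
    ∃ τ : ℝ, ∑ j, max 0 (x j - τ) = 1 := by
  obtain ⟨m, hm⟩ := Finite.exists_max x
  have hcont : Continuous fun τ : ℝ => ∑ j, max 0 (x j - τ) := by fun_prop
  refine mem_range_of_exists_le_of_exists_ge hcont ⟨x m, ?_⟩ ⟨x m - 1, ?_⟩
  · rw [Finset.sum_eq_zero fun j _ => max_eq_left (sub_nonpos.2 (hm j))]
    exact zero_le_one
  · calc (1 : ℝ) ≤ max 0 (x m - (x m - 1)) := by simp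
      _ ≤ ∑ j, max 0 (x j - (x m - 1)) :=
        Finset.single_le_sum (f := fun j => max 0 (x j - (x m - 1)))
          (fun j _ => le_max_left _ _) (Finset.mem_univ m)

/-- For every `d ≥ 1` and every `x ∈ ℝ^d`, there is a unique `τ ∈ ℝ` such that
`Σ_{j=1}^d max(0, x_j − τ) = 1`. -/
theorem stmt9 (d : ℕ) (hd : 1 ≤ d) (x : Fin d → ℝ) :
    ∃! τ : ℝ, ∑ j, max 0 (x j - τ) = 1 := by
  have : Nonempty (Fin d) := ⟨⟨0, hd⟩⟩
  refine existsUnique_of_exists_of_unique (exists_sum_max_zero_sub_eq_one x) fun σ τ hσ hτ => ?_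
  rcases lt_trichotomy σ τ with h | h | h
  · have := sum_max_zero_sub_lt_of_lt x h (hτ ▸ zero_lt_one)
    linarith
  · exact h
  · have := sum_max_zero_sub_lt_of_lt x h (hσ ▸ zero_lt_one)
    linarith
end

section
/- Let d ≥ 1 and x ∈ ℝ^d, and let x_(1) ≥ x_(2) ≥ … ≥ x_(d) be the coordinates of x sorted in decreasing order. The set {k ∈ {1, …, d} : 1 + k·x_(k) > Σ_{j=1}^k x_(j)} is nonempty; let T(x) be its maximum. Then the unique real number τ(x) satisfying Σ_{j=1}^d max(0, x_j − τ(x)) = 1 is given by τ(x) = (Σ_{j=1}^{T(x)} x_(j) − 1)/T(x). -/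
open Finset in
/-- A sum over `Fin d` whose terms vanish beyond `k` is a sum over the initial segment up to `k`. -/
lemma Fin.sum_Iic_eq_sum_of_forall_lt {d : ℕ} {f : Fin d → ℝ} {k : Fin d}
    (h : ∀ j, k < j → f j = 0) : ∑ j ∈ Iic k, f j = ∑ j, f j :=
  sum_subset (subset_univ _) fun j _ hj => h j (by simpa using hj)

/-- For decreasing `y` with sparsemax threshold `τ`, the support condition at index `k` holds
exactly when `y k` exceeds the threshold. -/
lemma Antitone.sum_Iic_lt_iff_threshold_lt {d : ℕ} {y : Fin d → ℝ} (hy : Antitone y) {τ : ℝ}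
    (hτ : ∑ j, max 0 (y j - τ) = 1) (k : Fin d) :
    ∑ j ∈ Finset.Iic k, y j < 1 + ((k : ℕ) + 1 : ℝ) * y k ↔ τ < y k := by
  have hsum (c : ℝ) : ∑ j ∈ Finset.Iic k, (y j - c) =
      ∑ j ∈ Finset.Iic k, y j - ((k : ℕ) + 1 : ℝ) * c := by
    simp [Finset.sum_sub_distrib, Fin.card_Iic]
  constructor
  · contrapose!
    intro hk
    have hle : ∑ j ∈ Finset.Iic k, max 0 (y j - τ) ≤ ∑ j ∈ Finset.Iic k, (y j - y k) := by
      refine Finset.sum_le_sum fun j hj => ?_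
      have := hy (Finset.mem_Iic.mp hj)
      exact max_le (by linarith) (by linarith)
    rw [Fin.sum_Iic_eq_sum_of_forall_lt fun j hj =>
      max_eq_left (by linarith [hy hj.le]), hτ, hsum] at hle
    linarith
  · intro hk
    have hle : ∑ j ∈ Finset.Iic k, (y j - τ) ≤ 1 := hτ ▸
      (Finset.sum_le_sum fun j _ => le_max_right _ _).trans
        (Finset.sum_le_sum_of_subset_of_nonneg (Finset.subset_univ _)
          fun j _ _ => le_max_left _ _)
    rw [hsum] at hle
    have : ((k : ℕ) + 1 : ℝ) * τ < ((k : ℕ) + 1 : ℝ) * y k := by gcongr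
    linarith

/-- Let `d ≥ 1`, `x ∈ ℝ^d`, and let `x_(1) ≥ … ≥ x_(d)` be the coordinates of `x` sorted in
decreasing order (realized via a permutation `σ` with `x ∘ σ` antitone, so `x_(k+1) = x (σ k)`
for `k : Fin d`). The set `{k : 1 + k·x_(k) > Σ_{j ≤ k} x_(j)}` (here indexed by `k : Fin d`,
representing the 1-indexed `k+1`) is nonempty, and if `T(x)` is its greatest element, then the
unique `τ(x)` with `Σ_j max(0, x_j − τ(x)) = 1` equals `(Σ_{j ≤ T(x)} x_(j) − 1)/T(x)`. -/
theorem stmt11 (d : ℕ) (hd : 1 ≤ d) (x : Fin d → ℝ)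
    (σ : Equiv.Perm (Fin d)) (hsort : Antitone (x ∘ σ))
    (τ : ℝ) (hτ : ∑ j, max 0 (x j - τ) = 1) :
    { k : Fin d | 1 + ((k : ℕ) + 1 : ℝ) * x (σ k) > ∑ j ∈ Finset.Iic k, x (σ j) }.Nonempty ∧
    ∀ T : Fin d,
      IsGreatest { k : Fin d | 1 + ((k : ℕ) + 1 : ℝ) * x (σ k) > ∑ j ∈ Finset.Iic k, x (σ j) }
        T →
      τ = ((∑ j ∈ Finset.Iic T, x (σ j)) - 1) / ((T : ℕ) + 1 : ℝ) := by
  have hτσ : ∑ j, max 0 ((x ∘ σ) j - τ) = 1 :=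
    (Equiv.sum_comp σ fun j => max 0 (x j - τ)).trans hτ
  have hset : {k : Fin d | 1 + ((k : ℕ) + 1 : ℝ) * x (σ k) > ∑ j ∈ Finset.Iic k, x (σ j)} =
      {k | τ < x (σ k)} :=
    Set.ext fun k => hsort.sum_Iic_lt_iff_threshold_lt hτσ k
  rw [hset]
  constructor
  · by_contra! hempty
    have hle (j : Fin d) : x (σ j) ≤ τ :=
      not_lt.mp (Set.eq_empty_iff_forall_notMem.mp hempty j)
    have hzero : ∑ j, max 0 ((x ∘ σ) j - τ) = 0 :=
      Finset.sum_eq_zero fun j _ => max_eq_left (sub_nonpos.mpr (hle j))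
    linarith
  · rintro T ⟨hT, hmax⟩
    rw [← Fin.sum_Iic_eq_sum_of_forall_lt (f := fun j => max 0 ((x ∘ σ) j - τ)) (k := T) fun j hj =>
      max_eq_left (sub_nonpos.mpr (not_lt.mp fun h => hj.not_ge (hmax h)))] at hτσ
    have hsum : ∑ j ∈ Finset.Iic T, (x (σ j) - τ) = 1 := by
      refine Eq.trans ?_ hτσ
      refine Finset.sum_congr rfl fun j hj => (max_eq_right (sub_nonneg.mpr ?_)).symm
      exact (Set.mem_ofPred.mp hT).le.trans (hsort (Finset.mem_Iic.mp hj))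
    rw [Finset.sum_sub_distrib, Finset.sum_const, Fin.card_Iic, nsmul_eq_mul] at hsum
    push_cast at hsum
    rw [eq_div_iff (by positivity)]
    linarith
end

section
/- Let d ≥ 1 and let x ∈ ℝ^d be such that x_j ≠ τ(x) for every j ∈ {1, …, d}. Then the map sparsemax : ℝ^d → ℝ^d is differentiable at x, with Jacobian matrix Diag(s) − (s sᵀ)/|S(x)|, where s ∈ ℝ^d is the vector whose i-th entry is 1 if i ∈ S(x) and 0 otherwise; equivalently, the derivative at x maps v ∈ ℝ^d to the vector whose j-th coordinate is s_j·(v_j − (Σ_{i ∈ S(x)} v_i)/|S(x)|). -/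
/-- The Jacobian `Diag(s) - s sᵀ / |S|` of an indicator vector `s` of `S`, in coordinates. -/
theorem diagonal_sub_vecMulVec_mulVec {ι : Type*} [Fintype ι] [DecidableEq ι]
    (S : Finset ι) (s : ι → ℝ) (hs : ∀ i, s i = if i ∈ S then 1 else 0) (v : ι → ℝ) (j : ι) :
    (Matrix.diagonal s - (S.card : ℝ)⁻¹ • Matrix.vecMulVec s s).mulVec v j =
      s j * (v j - (∑ i ∈ S, v i) / (S.card : ℝ)) := by
  have hdot : s ⬝ᵥ v = ∑ i ∈ S, v i := by
    simp [dotProduct, hs, Finset.sum_ite_mem]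
  rw [Matrix.sub_mulVec, Matrix.smul_mulVec, Matrix.vecMulVec_mulVec, hdot]
  simp only [Pi.sub_apply, Pi.smul_apply, Matrix.mulVec_diagonal, smul_eq_mul,
    MulOpposite.smul_eq_mul_unop, MulOpposite.unop_op]
  ring

/-- If the signs of the coordinates `y j - t` are given by membership in `S`, the positive part
of `y j - t` is `y j - t` on `S` and `0` off `S`. -/
theorem max_zero_sub_eq_ite {ι : Type*} [DecidableEq ι] {S : Finset ι} {y : ι → ℝ} {t : ℝ}
    (h : ∀ j, if j ∈ S then t < y j else y j < t) (j : ι) :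
    max 0 (y j - t) = if j ∈ S then y j - t else 0 := by
  have hj := h j
  split_ifs at hj ⊢
  · exact max_eq_right (sub_nonneg.2 hj.le)
  · exact max_eq_left (sub_nonpos.2 hj.le)

/-- Let `d ≥ 1` and let `sm : ℝ^d → ℝ^d` be the sparsemax map, characterized (per its
closed form) by `sm y = (max(0, y_j − τ'))_j` whenever `Σ_j max(0, y_j − τ') = 1`. Let
`x ∈ ℝ^d` and `τ = τ(x)` (i.e. `Σ_j max(0, x_j − τ) = 1`), and assume `x_j ≠ τ` for all `j`.
Let `S = S(x) = {j : [sparsemax(x)]_j > 0}` be the support of `sparsemax(x)` and let `s` be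
its indicator vector. Then `sm` is differentiable at `x` with Jacobian matrix
`Diag(s) − s sᵀ / |S|`; equivalently, this derivative maps `v` to the vector with `j`-th
coordinate `s_j · (v_j − (Σ_{i ∈ S} v_i)/|S|)`. -/
theorem stmt13 (d : ℕ) (hd : 1 ≤ d)
    (sm : (Fin d → ℝ) → (Fin d → ℝ))
    (hsm : ∀ (y : Fin d → ℝ) (τ' : ℝ), (∑ j, max 0 (y j - τ')) = 1 →
      sm y = fun j => max 0 (y j - τ'))
    (x : Fin d → ℝ) (τ : ℝ) (hτ : ∑ j, max 0 (x j - τ) = 1)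
    (hne : ∀ j, x j ≠ τ)
    (S : Finset (Fin d)) (hS : ∀ j, j ∈ S ↔ 0 < max 0 (x j - τ))
    (s : Fin d → ℝ) (hs : ∀ i, s i = if i ∈ S then 1 else 0) :
    HasFDerivAt sm (LinearMap.toContinuousLinearMap (Matrix.mulVecLin
      (Matrix.diagonal s - (S.card : ℝ)⁻¹ • Matrix.vecMulVec s s))) x ∧
    ∀ (v : Fin d → ℝ) (j : Fin d),
      (Matrix.diagonal s - (S.card : ℝ)⁻¹ • Matrix.vecMulVec s s).mulVec v j =
        s j * (v j - (∑ i ∈ S, v i) / (S.card : ℝ)) := by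
  have hJ := diagonal_sub_vecMulVec_mulVec S s hs
  refine ⟨?_, hJ⟩
  have hsign : ∀ j, if j ∈ S then τ < x j else x j < τ := by
    intro j
    have hj := hS j
    rw [lt_max_iff, sub_pos] at hj
    simp only [lt_irrefl, false_or] at hj
    split_ifs with h
    · exact hj.1 h
    · exact lt_of_le_of_ne (not_lt.1 (mt hj.2 h)) (hne j)
  have hsum : ∑ i ∈ S, (x i - τ) = 1 := by
    simpa [max_zero_sub_eq_ite hsign, Finset.sum_ite_mem] using hτ
  have hcard : (S.card : ℝ) ≠ 0 := by
    intro h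
    have hempty : S = ∅ := Finset.card_eq_zero.1 (by exact_mod_cast h)
    simp [hempty] at hsum
  let t : (Fin d → ℝ) → ℝ := fun y => τ + (∑ i ∈ S, y i - ∑ i ∈ S, x i) / S.card
  have ht : Continuous t := by fun_prop
  have htx : t x = τ := by simp [t]
  have hev : ∀ᶠ y in nhds x, ∀ j, if j ∈ S then t y < y j else y j < t y := by
    refine Filter.eventually_all.2 fun j => ?_
    have hj := hsign j
    split_ifs at hj ⊢
    · exact ht.continuousAt.eventually_lt (continuous_apply j).continuousAt (by rwa [htx])
    · exact (continuous_apply j).continuousAt.eventually_lt ht.continuousAt (by rwa [htx])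
  let L := LinearMap.toContinuousLinearMap (Matrix.mulVecLin
    (Matrix.diagonal s - (S.card : ℝ)⁻¹ • Matrix.vecMulVec s s))
  refine (L.hasFDerivAt.add_const
    (fun j => s j * ((∑ i ∈ S, x i) / S.card - τ))).congr_of_eventuallyEq ?_
  filter_upwards [hev] with y hy
  have hsumy : ∑ j, max 0 (y j - t y) = 1 := by
    simp only [max_zero_sub_eq_ite hy, Finset.sum_ite_mem, Finset.univ_inter]
    rw [← hsum]
    simp only [Finset.sum_sub_distrib, Finset.sum_const, nsmul_eq_mul, t]
    field_simp
    ring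
  rw [hsm y (t y) hsumy]
  funext j
  have hL : L y j = s j * (y j - (∑ i ∈ S, y i) / S.card) := hJ y j
  rw [max_zero_sub_eq_ite hy, Pi.add_apply, hL, hs]
  split_ifs
  · simp only [t]
    ring
  · simp
end
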